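/- Let φ(u) = u (the identity, giving the classical Tonelli variation V := V^φ), let the kernels K_w be non-negative with ∫_{ℝ^N_+} K_w(t) ⟨t⟩^{−1} dt = 1 for every w > 0, and let f : ℝ^N_+ → ℝ be measurable, of bounded Tonelli variation, and in the domain of the operators T_w. Then for every w > 0, V[T_w f] ≤ V[f] (the operators T_w do not augment the variation). -/

import Mathlib

open MeasureTheory Filter Set Asymptotics
open scoped ENNReal

noncomputable section

/-- The class `Φ`: `φ : [0,∞) → [0,∞)` convex, vanishing exactly at `0`,
with `φ(u)/u → 0` as `u → 0⁺`. -/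
def IsPhiFun (φ : ℝ → ℝ) : Prop :=
  ConvexOn ℝ (Set.Ici 0) φ ∧ (∀ u, 0 ≤ u → 0 ≤ φ u) ∧
  (∀ u, 0 ≤ u → (φ u = 0 ↔ u = 0)) ∧
  Tendsto (fun u => φ u / u) (nhdsWithin 0 (Set.Ioi 0)) (nhds 0)

/-- The positive orthant `ℝ^N_+ = (0,∞)^N`. -/
def RPos (N : ℕ) : Set (Fin N → ℝ) := {x | ∀ i, 0 < x i}

/-- `⟨t⟩ := ∏ᵢ tᵢ`. -/
def prodCoord {N : ℕ} (t : Fin N → ℝ) : ℝ := ∏ i, t i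

/-- Euclidean distance `|1 - t|`. -/
def distOne {N : ℕ} (t : Fin N → ℝ) : ℝ := Real.sqrt (∑ i, (1 - t i) ^ 2)

/-- Euclidean norm `|log t|` of `log t := (log t₁, …, log t_N)`. -/
def logNorm {N : ℕ} (t : Fin N → ℝ) : ℝ := Real.sqrt (∑ i, Real.log (t i) ^ 2)

/-- `t^w := (t₁^w, …, t_N^w)`. -/
def powVec {N : ℕ} (t : Fin N → ℝ) (w : ℝ) : Fin N → ℝ := fun i => t i ^ w

/-- The (Musielak–Orlicz) `φ`-variation of `g` on `[a,b]`:
`sup_D ∑ᵢ φ(|g(sᵢ) - g(sᵢ₋₁)|)` over all partitions `D` of `[a,b]`. -/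
def phiVar1 (φ : ℝ → ℝ) (a b : ℝ) (g : ℝ → ℝ) : ℝ≥0∞ :=
  ⨆ (n : ℕ) (u : Fin (n + 1) → ℝ) (_ : Monotone u) (_ : u 0 = a) (_ : u (Fin.last n) = b),
    ∑ i : Fin n, ENNReal.ofReal (φ |g (u i.succ) - g (u i.castSucc)|)

/-- The point of `ℝ^N` obtained from `x'` (coordinates `≠ j`) by inserting `s`
at the `j`-th coordinate. -/
def insertCoord {N : ℕ} (j : Fin N) (x' : {i : Fin N // i ≠ j} → ℝ) (s : ℝ) :
    Fin N → ℝ :=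
  fun i => if h : i = j then s else x' ⟨i, h⟩

/-- `Φ^φ_j(f, I)`: the integral over `I'_j` (with weight `⟨x'_j⟩⁻¹`) of the `φ`-variations
of the `j`-th sections of `f`, where `I = ∏ᵢ [aᵢ, bᵢ]`. -/
def secVar {N : ℕ} (φ : ℝ → ℝ) (f : (Fin N → ℝ) → ℝ) (a b : Fin N → ℝ) (j : Fin N) :
    ℝ≥0∞ :=
  ∫⁻ x' in Set.pi Set.univ (fun i : {i : Fin N // i ≠ j} => Set.Icc (a i.1) (b i.1)),
    phiVar1 φ (a j) (b j) (fun s => f (insertCoord j x' s)) *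
      ENNReal.ofReal ((∏ i : {i : Fin N // i ≠ j}, x' i)⁻¹)

/-- `Φ^φ(f, I) := (∑_j Φ^φ_j(f,I)²)^{1/2}`. -/
def boxPhi {N : ℕ} (φ : ℝ → ℝ) (f : (Fin N → ℝ) → ℝ) (a b : Fin N → ℝ) : ℝ≥0∞ :=
  (∑ j : Fin N, secVar φ f a b j ^ 2) ^ ((1 : ℝ) / 2)

/-- `{J_1, …, J_m}`, with `J_k = ∏ᵢ [c k i, d k i]`, is a partition of `I = ∏ᵢ [aᵢ, bᵢ]`
into non-overlapping `N`-dimensional intervals covering `I`. -/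
def IsBoxPartition {N : ℕ} (a b : Fin N → ℝ) {m : ℕ} (c d : Fin m → Fin N → ℝ) : Prop :=
  (∀ k i, c k i ≤ d k i) ∧
  (⋃ k, Set.pi Set.univ fun i => Set.Icc (c k i) (d k i)) =
    Set.pi Set.univ (fun i => Set.Icc (a i) (b i)) ∧
  Pairwise fun k l =>
    Disjoint (Set.pi Set.univ fun i => Set.Ioo (c k i) (d k i))
      (Set.pi Set.univ fun i => Set.Ioo (c l i) (d l i))

/-- The multidimensional (Tonelli-type) `φ`-variation `V^φ_I[f]` of `f` on
`I = ∏ᵢ [aᵢ, bᵢ]`: the sup of `∑ₖ Φ^φ(f, J_k)` over all partitions of `I` into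
`N`-dimensional intervals. -/
def varOn {N : ℕ} (φ : ℝ → ℝ) (f : (Fin N → ℝ) → ℝ) (a b : Fin N → ℝ) : ℝ≥0∞ :=
  ⨆ (m : ℕ) (c : Fin m → Fin N → ℝ) (d : Fin m → Fin N → ℝ) (_ : IsBoxPartition a b c d),
    ∑ k, boxPhi φ f (c k) (d k)

/-- `V^φ[f]`, the `φ`-variation of `f` over the whole `ℝ^N_+`: the sup of `V^φ_I[f]`
over all intervals `I ⊂ ℝ^N_+`. -/
def totalVar {N : ℕ} (φ : ℝ → ℝ) (f : (Fin N → ℝ) → ℝ) : ℝ≥0∞ :=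
  ⨆ (a : Fin N → ℝ) (b : Fin N → ℝ) (_ : ∀ i, 0 < a i) (_ : ∀ i, a i ≤ b i),
    varOn φ f a b

/-- `f ∈ BV^φ(ℝ^N_+)`: `f` measurable with `V^φ[λ f] < ∞` for some `λ > 0`. -/
def MemBVphi {N : ℕ} (φ : ℝ → ℝ) (f : (Fin N → ℝ) → ℝ) : Prop :=
  Measurable f ∧ ∃ l > (0 : ℝ), totalVar φ (fun x => l * f x) < ⊤

/-- The Mellin-type operator `(T f)(s) := ∫_{ℝ^N_+} K(t) f(st) ⟨t⟩⁻¹ dt`. -/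
def mellinOp {N : ℕ} (K : (Fin N → ℝ) → ℝ) (f : (Fin N → ℝ) → ℝ) (s : Fin N → ℝ) : ℝ :=
  ∫ t in RPos N, K t * f (s * t) * (prodCoord t)⁻¹

/-- `f` belongs to the domain of the operators `T_w`: the defining integrals exist
finitely for every `s ∈ ℝ^N_+` and `w > 0`. -/
def InDomain {N : ℕ} (K : ℝ → (Fin N → ℝ) → ℝ) (f : (Fin N → ℝ) → ℝ) : Prop :=
  ∀ w > (0 : ℝ), ∀ s ∈ RPos N,
    IntegrableOn (fun t => K w t * f (s * t) * (prodCoord t)⁻¹) (RPos N)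

/-- Condition `(K_w.1)` with absolute constant `A`: each `K_w` is measurable and
integrable w.r.t. `⟨t⟩⁻¹ dt`, with `∫ |K_w| dμ ≤ A` and `∫ K_w dμ = 1`. -/
def KernelCond1 {N : ℕ} (K : ℝ → (Fin N → ℝ) → ℝ) (A : ℝ) : Prop :=
  ∀ w > (0 : ℝ), Measurable (K w) ∧
    IntegrableOn (fun t => K w t * (prodCoord t)⁻¹) (RPos N) ∧
    (∫ t in RPos N, |K w t| * (prodCoord t)⁻¹) ≤ A ∧
    (∫ t in RPos N, K w t * (prodCoord t)⁻¹) = 1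

/-- Condition `(K_w.2)`: for every `δ ∈ (0,1)`,
`∫_{|1-t|>δ} |K_w(t)| ⟨t⟩⁻¹ dt → 0` as `w → +∞`. -/
def KernelCond2 {N : ℕ} (K : ℝ → (Fin N → ℝ) → ℝ) : Prop :=
  ∀ δ : ℝ, 0 < δ → δ < 1 →
    Tendsto (fun w => ∫ t in {t ∈ RPos N | δ < distOne t}, |K w t| * (prodCoord t)⁻¹)
      atTop (nhds 0)

/-- The `φ`-modulus of smoothness `ω^φ(f, δ) := sup_{|1-t| ≤ δ} V^φ[τ_t f - f]`. -/
def modSmooth {N : ℕ} (φ : ℝ → ℝ) (f : (Fin N → ℝ) → ℝ) (δ : ℝ) : ℝ≥0∞ :=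
  ⨆ (t : Fin N → ℝ) (_ : t ∈ RPos N) (_ : distOne t ≤ δ),
    totalVar φ (fun s => f (s * t) - f s)

/-- `f` is locally `φ`-absolutely continuous on `ℝ^N_+` (uniformly, in the sense of
Tonelli) with constant `l`. -/
def LocACphiWith {N : ℕ} (φ : ℝ → ℝ) (f : (Fin N → ℝ) → ℝ) (l : ℝ) : Prop :=
  ∀ a b : Fin N → ℝ, (∀ i, 0 < a i) → (∀ i, a i ≤ b i) → ∀ j : Fin N,
    ∀ ε > (0 : ℝ), ∃ δ > (0 : ℝ),
      ∀ᵐ x' ∂(volume.restrict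
          (Set.pi Set.univ (fun i : {i : Fin N // i ≠ j} => Set.Icc (a i.1) (b i.1)))),
        ∀ n : ℕ, ∀ α β : Fin n → ℝ,
          (∀ i, a j ≤ α i ∧ α i ≤ β i ∧ β i ≤ b j) →
          (Pairwise fun i i' =>
            Disjoint (Set.Ioo (α i) (β i)) (Set.Ioo (α i') (β i'))) →
          (∑ i, φ (β i - α i)) < δ →
          (∑ i, φ (l * |f (insertCoord j x' (β i)) - f (insertCoord j x' (α i))|)) < ε

/-- `f ∈ AC^φ(ℝ^N_+)`: `f` is measurable, of bounded `φ`-variation and locally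
`φ`-absolutely continuous on `ℝ^N_+`. -/
def MemACphi {N : ℕ} (φ : ℝ → ℝ) (f : (Fin N → ℝ) → ℝ) : Prop :=
  MemBVphi φ f ∧ ∃ l > (0 : ℝ), LocACphiWith φ f l

/-- `{K_w}` is an `α`-singular kernel: for every `δ ∈ (0,1)`,
`∫_{|1-t|>δ} |K_w(t)| ⟨t⟩⁻¹ dt = O(w^{-α})` as `w → +∞`. -/
def AlphaSingular {N : ℕ} (K : ℝ → (Fin N → ℝ) → ℝ) (α : ℝ) : Prop :=
  ∀ δ : ℝ, 0 < δ → δ < 1 →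
    (fun w => ∫ t in {t ∈ RPos N | δ < distOne t}, |K w t| * (prodCoord t)⁻¹)
      =O[atTop] fun w : ℝ => w ^ (-α)

/-- The Lipschitz class `V^φ Lip_N(α)`: `f ∈ BV^φ(ℝ^N_+)` such that, for some `μ > 0`,
`V^φ[μ(τ_t f - f)] = O(|log t|^α)` as `|1 - t| → 0`. -/
def MemLipAlpha {N : ℕ} (φ : ℝ → ℝ) (α : ℝ) (f : (Fin N → ℝ) → ℝ) : Prop :=
  MemBVphi φ f ∧ ∃ μ > (0 : ℝ), ∃ C > (0 : ℝ), ∃ η > (0 : ℝ),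
    ∀ t ∈ RPos N, distOne t ≤ η →
      totalVar φ (fun x => μ * (f (x * t) - f x)) ≤ ENNReal.ofReal (C * logNorm t ^ α)

/-- A finite Borel measure of an analytic set is approximated from inside by compact sets. -/
theorem exists_isCompact_subset_range_le_measure {X : Type*} [TopologicalSpace X]
    [MeasurableSpace X] (μ : Measure X) [μ.OuterRegular] {f : (ℕ → ℕ) → X} (hf : Continuous f)
    {c : ℝ≥0∞} (hc : c < μ (range f)) : ∃ k ⊆ range f, IsCompact k ∧ c ≤ μ k := by
  have step : ∀ (k : ℕ) (S : {S : Set (ℕ → ℕ) // c < μ (f '' S)}),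
      ∃ m : ℕ, c < μ (f '' (S.1 ∩ {σ | σ k ≤ m})) := by
    rintro k ⟨S, hS⟩
    have hmono : Monotone fun m : ℕ => f '' (S ∩ {σ | σ k ≤ m}) := fun m m' h =>
      image_mono (inter_subset_inter_right _ fun σ (hσ : σ k ≤ m) => hσ.trans h)
    have hU : ⋃ m : ℕ, f '' (S ∩ {σ | σ k ≤ m}) = f '' S := by
      rw [← image_iUnion, ← inter_iUnion]
      congr 1
      refine inter_eq_left.2 fun σ _ => mem_iUnion.2 ⟨σ k, le_refl (σ k)⟩
    rw [← hU, hmono.measure_iUnion] at hS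
    exact lt_iSup_iff.1 hS
  choose m hm using step
  let S : ℕ → {S : Set (ℕ → ℕ) // c < μ (f '' S)} := fun k =>
    Nat.rec ⟨univ, by simpa using hc⟩ (fun k T => ⟨_, hm k T⟩) k
  let n : ℕ → ℕ := fun k => m k (S k)
  have hS : ∀ k, ∀ σ ∈ (S k).1, ∀ i < k, σ i ≤ n i := by
    intro k
    induction k with
    | zero => intro σ _ i hi; omega
    | succ k ih =>
      intro σ hσ i hi
      have hσ' : σ ∈ (S k).1 ∩ {σ | σ k ≤ n k} := hσ
      rcases Nat.lt_succ_iff_lt_or_eq.1 hi with h | rfl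
      · exact ih σ hσ'.1 i h
      · exact hσ'.2
  have hK : IsCompact (Set.pi univ fun i => Iic (n i)) :=
    isCompact_univ_pi fun i => (finite_Iic (n i)).isCompact
  refine ⟨f '' (Set.pi univ fun i => Iic (n i)), image_subset_range _ _, hK.image hf, ?_⟩
  rw [Set.measure_eq_iInf_isOpen]
  refine le_iInf₂ fun U hKU => le_iInf fun hU => ?_
  obtain ⟨k, hk⟩ : ∃ k, f '' (S k).1 ⊆ U := by
    by_contra! hcon
    have : ∀ k, ∃ σ ∈ (S k).1, f σ ∉ U := fun k => by
      obtain ⟨_, ⟨σ, hσ, rfl⟩, h⟩ := not_subset.1 (hcon k)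
      exact ⟨σ, hσ, h⟩
    choose σ hσ hσU using this
    obtain ⟨τ, hτ, g, hg, hlim⟩ := hK.tendsto_subseq (x := fun k i => min (σ k i) (n i))
      fun k i _ => mem_Iic.2 (min_le_right _ _)
    have hlim' : Tendsto (fun k => σ (g k)) atTop (nhds τ) := by
      rw [tendsto_pi_nhds] at hlim ⊢
      intro i
      refine (hlim i).congr' ?_
      filter_upwards [eventually_gt_atTop i] with k hk
      exact min_eq_left (hS _ _ (hσ (g k)) i (hk.trans_le (hg.id_le k)))
    have hτU : f τ ∈ Uᶜ := hU.isClosed_compl.mem_of_tendsto ((hf.tendsto τ).comp hlim')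
      (Eventually.of_forall fun k => hσU (g k))
    exact hτU (hKU (mem_image_of_mem f hτ))
  exact (S k).2.le.trans (measure_mono hk)

/-- Analytic sets are measurable for the completion of every finite Borel measure. -/
theorem nullMeasurableSet_of_analyticSet {X : Type*} [TopologicalSpace X] [T2Space X]
    [MeasurableSpace X] [BorelSpace X] (μ : Measure X) [IsFiniteMeasure μ] [μ.OuterRegular]
    {s : Set X} (hs : AnalyticSet s) : NullMeasurableSet s μ := by
  rw [AnalyticSet] at hs
  rcases hs with rfl | ⟨f, hf, rfl⟩
  · exact nullMeasurableSet_empty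
  rcases eq_or_ne (μ (range f)) 0 with h0 | h0
  · exact NullMeasurableSet.of_null h0
  obtain ⟨c, -, hc, hlim⟩ := exists_seq_strictMono_tendsto' (pos_iff_ne_zero.2 h0)
  choose k hks hkc hck using fun n =>
    exists_isCompact_subset_range_le_measure μ hf (hc n).2
  have hmeas : MeasurableSet (⋃ n, k n) := .iUnion fun n => (hkc n).measurableSet
  refine hmeas.nullMeasurableSet.congr (ae_eq_of_subset_of_measure_ge (iUnion_subset hks) ?_
    hmeas.nullMeasurableSet (measure_ne_top _ _))
  exact le_of_tendsto' hlim fun n => (hck n).trans (measure_mono (subset_iUnion k n))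

theorem aemeasurable_phiVar1 {P : Type*} [TopologicalSpace P] [PolishSpace P] [MeasurableSpace P]
    [BorelSpace P] (μ : Measure P) [IsFiniteMeasure μ] [μ.OuterRegular] {φ : ℝ → ℝ}
    (hφ : Measurable φ) (a b : ℝ) {g : P → ℝ → ℝ} (hg : Measurable (Function.uncurry g)) :
    AEMeasurable (fun p => phiVar1 φ a b (g p)) μ := by
  refine NullMeasurable.aemeasurable ?_
  suffices h : @Measurable (NullMeasurableSpace P μ) ℝ≥0∞ _ _ fun p => phiVar1 φ a b (g p) from
    fun s hs => h hs
  refine measurable_of_Ioi fun c => ?_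
  have key : (fun p => phiVar1 φ a b (g p)) ⁻¹' Ioi c = ⋃ n : ℕ, Prod.fst ''
      {q : P × (Fin (n + 1) → ℝ) | Monotone q.2 ∧ q.2 0 = a ∧ q.2 (Fin.last n) = b ∧
        c < ∑ i : Fin n, ENNReal.ofReal (φ |g q.1 (q.2 i.succ) - g q.1 (q.2 i.castSucc)|)} := by
    ext p
    simp only [phiVar1, mem_preimage, mem_Ioi, lt_iSup_iff, mem_iUnion, mem_image, exists_prop]
    constructor
    · rintro ⟨n, u, hu, h0, h1, h⟩
      exact ⟨n, (p, u), ⟨hu, h0, h1, h⟩, rfl⟩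
    · rintro ⟨n, ⟨_, u⟩, ⟨hu, h0, h1, h⟩, rfl⟩
      exact ⟨n, u, hu, h0, h1, h⟩
  have : NullMeasurableSet ((fun p => phiVar1 φ a b (g p)) ⁻¹' Ioi c) μ := by
    rw [key]
    refine .iUnion fun n => nullMeasurableSet_of_analyticSet μ ?_
    refine MeasurableSet.analyticSet_image ?_ measurable_fst
    have hev : ∀ i : Fin (n + 1), Measurable fun q : P × (Fin (n + 1) → ℝ) => q.2 i := fun i =>
      (measurable_pi_apply i).comp measurable_snd
    have hgev : ∀ i : Fin (n + 1), Measurable fun q : P × (Fin (n + 1) → ℝ) => g q.1 (q.2 i) :=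
      fun i => hg.comp (measurable_fst.prodMk (hev i))
    have hmono : MeasurableSet {q : P × (Fin (n + 1) → ℝ) | Monotone q.2} := by
      simp only [Monotone, ofPred_forall]
      exact .iInter fun i => .iInter fun k => .iInter fun _ => measurableSet_le (hev i) (hev k)
    have hsum : Measurable fun q : P × (Fin (n + 1) → ℝ) =>
        ∑ i : Fin n, ENNReal.ofReal (φ |g q.1 (q.2 i.succ) - g q.1 (q.2 i.castSucc)|) :=
      Finset.measurable_sum _ fun i _ => ENNReal.measurable_ofReal.comp <| hφ.comp <|
        continuous_abs.measurable.comp ((hgev i.succ).sub (hgev i.castSucc))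
    exact hmono.inter <| (hev 0 (measurableSet_singleton a)).inter <|
      (hev (Fin.last n) (measurableSet_singleton b)).inter <| hsum measurableSet_Ioi
  exact this

theorem le_phiVar1 (φ : ℝ → ℝ) (g : ℝ → ℝ) {n : ℕ} {u : Fin (n + 1) → ℝ} (hu : Monotone u) {a b : ℝ}
    (h0 : u 0 = a) (h1 : u (Fin.last n) = b) :
    ∑ i : Fin n, ENNReal.ofReal (φ |g (u i.succ) - g (u i.castSucc)|) ≤ phiVar1 φ a b g :=
  le_iSup_of_le n <| le_iSup_of_le u <| le_iSup_of_le hu <| le_iSup_of_le h0 <|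
    le_iSup_of_le h1 le_rfl

theorem phiVar1_comp_mul_le (φ : ℝ → ℝ) (a b : ℝ) {r : ℝ} (hr : 0 ≤ r) (g : ℝ → ℝ) :
    phiVar1 φ a b (fun s => g (s * r)) ≤ phiVar1 φ (a * r) (b * r) g := by
  refine iSup_le fun n => iSup_le fun u => iSup_le fun hu => iSup_le fun h0 => iSup_le fun h1 => ?_
  exact le_phiVar1 φ g (u := fun i => u i * r)
    (fun i k h => mul_le_mul_of_nonneg_right (hu h) hr) (congrArg (· * r) h0) (congrArg (· * r) h1)

theorem insertCoord_mul {N : ℕ} (j : Fin N) (x' : {i : Fin N // i ≠ j} → ℝ) (s : ℝ)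
    (t : Fin N → ℝ) :
    insertCoord j x' s * t = insertCoord j (fun i => t i.1 * x' i) (s * t j) := by
  ext i
  by_cases h : i = j
  · subst h; simp [insertCoord]
  · simp [insertCoord, h, mul_comm]

theorem insertCoord_mem_RPos {N : ℕ} {j : Fin N} {x' : {i : Fin N // i ≠ j} → ℝ} {s : ℝ}
    (hx : ∀ i, 0 < x' i) (hs : 0 < s) : insertCoord j x' s ∈ RPos N := by
  intro i
  by_cases h : i = j
  · simpa [insertCoord, h] using hs
  · simpa [insertCoord, h] using hx ⟨i, h⟩

theorem measurable_insertCoord {N : ℕ} (j : Fin N) :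
    Measurable fun q : ({i : Fin N // i ≠ j} → ℝ) × ℝ => insertCoord j q.1 q.2 := by
  refine measurable_pi_lambda _ fun i => ?_
  by_cases h : i = j
  · simpa [insertCoord, h] using measurable_snd
  · simp only [insertCoord, h, dite_false]
    exact (measurable_pi_apply _).comp measurable_fst

theorem lintegral_comp_mul_pi {ι : Type*} [Fintype ι] {t : ι → ℝ} (ht : ∀ i, 0 < t i)
    (H : (ι → ℝ) → ℝ≥0∞) :
    ∫⁻ x : ι → ℝ, H (fun i => t i * x i) * ENNReal.ofReal (∏ i, t i) = ∫⁻ y, H y := by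
  classical
  let e : (ι → ℝ) ≃ᵐ (ι → ℝ) :=
    MeasurableEquiv.piCongrRight fun i => MeasurableEquiv.mulLeft₀ (t i) (ht i).ne'
  have hdet : (Matrix.diagonal t).det = ∏ i, t i := Matrix.det_diagonal
  have hpos : 0 < ∏ i, t i := Finset.prod_pos fun i _ => ht i
  have hmap := Real.smul_map_diagonal_volume_pi (D := t) (by rw [hdet]; exact hpos.ne')
  have he : (Matrix.toLin' (Matrix.diagonal t) : (ι → ℝ) → ι → ℝ) = e := by
    ext x i
    simp only [Matrix.toLin'_apply, Matrix.mulVec_diagonal]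
    rfl
  rw [he, hdet, abs_of_pos hpos] at hmap
  conv_rhs => rw [← hmap, lintegral_smul_measure, lintegral_map_equiv, smul_eq_mul, mul_comm]
  exact lintegral_mul_const' _ _ ENNReal.ofReal_ne_top

theorem secVar_comp_mul_le {N : ℕ} (φ : ℝ → ℝ) (f : (Fin N → ℝ) → ℝ) (a b : Fin N → ℝ)
    (j : Fin N) {t : Fin N → ℝ} (ht : t ∈ RPos N) :
    secVar φ (fun s => f (s * t)) a b j ≤ secVar φ f (a * t) (b * t) j := by
  have hmeas : ∀ a b : Fin N → ℝ, MeasurableSet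
      (Set.pi Set.univ (fun i : {i : Fin N // i ≠ j} => Set.Icc (a i.1) (b i.1))) := fun a b =>
    .univ_pi fun i => measurableSet_Icc
  rw [secVar, secVar, ← lintegral_indicator (hmeas _ _), ← lintegral_indicator (hmeas _ _)]
  refine le_of_le_of_eq (lintegral_mono fun x' => ?_)
    (lintegral_comp_mul_pi (t := fun i : {i : Fin N // i ≠ j} => t i.1) (fun i => ht i.1) _)
  by_cases hx : x' ∈ Set.pi Set.univ
      (fun i : {i : Fin N // i ≠ j} => Set.Icc (a i.1) (b i.1))
  · have hx' : (fun i : {i : Fin N // i ≠ j} => t i.1 * x' i) ∈ Set.pi Set.univ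
        (fun i : {i : Fin N // i ≠ j} => Set.Icc ((a * t) i.1) ((b * t) i.1)) := by
      intro i hi
      have h := hx i hi
      simp only [Pi.mul_apply, mem_Icc, mul_comm (t i.1)]
      exact ⟨mul_le_mul_of_nonneg_right h.1 (ht i.1).le,
        mul_le_mul_of_nonneg_right h.2 (ht i.1).le⟩
    have hprod : 0 < ∏ i : {i : Fin N // i ≠ j}, t i.1 := Finset.prod_pos fun i _ => ht i.1
    simp only [indicator_of_mem hx, indicator_of_mem hx', insertCoord_mul]
    rw [mul_assoc, ← ENNReal.ofReal_mul' hprod.le, Finset.prod_mul_distrib, mul_inv_rev, mul_assoc,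
      inv_mul_cancel₀ hprod.ne', mul_one]
    exact mul_le_mul_left (phiVar1_comp_mul_le φ (a j) (b j) (ht j).le
      fun s => f (insertCoord j (fun i => t i.1 * x' i) s)) _
  · simp only [indicator_of_notMem hx, zero_le]

theorem boxPhi_comp_mul_le {N : ℕ} (φ : ℝ → ℝ) (f : (Fin N → ℝ) → ℝ) (a b : Fin N → ℝ)
    {t : Fin N → ℝ} (ht : t ∈ RPos N) :
    boxPhi φ (fun s => f (s * t)) a b ≤ boxPhi φ f (a * t) (b * t) := by
  unfold boxPhi
  gcongr
  exact secVar_comp_mul_le φ f a b _ ht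

theorem IsBoxPartition.mul {N m : ℕ} {a b : Fin N → ℝ} {c d : Fin m → Fin N → ℝ}
    (h : IsBoxPartition a b c d) {t : Fin N → ℝ} (ht : t ∈ RPos N) :
    IsBoxPartition (a * t) (b * t) (fun k => c k * t) (fun k => d k * t) := by
  have hIcc : ∀ (p q x : Fin N → ℝ), x ∈ Set.pi univ (fun i => Icc ((p * t) i) ((q * t) i)) ↔
      x / t ∈ Set.pi univ (fun i => Icc (p i) (q i)) := fun p q x => by
    simp only [Set.mem_pi, mem_Icc, Pi.mul_apply, Pi.div_apply, le_div_iff₀ (ht _),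
      div_le_iff₀ (ht _)]
  have hIoo : ∀ (p q x : Fin N → ℝ), x ∈ Set.pi univ (fun i => Ioo ((p * t) i) ((q * t) i)) ↔
      x / t ∈ Set.pi univ (fun i => Ioo (p i) (q i)) := fun p q x => by
    simp only [Set.mem_pi, mem_Ioo, Pi.mul_apply, Pi.div_apply, lt_div_iff₀ (ht _),
      div_lt_iff₀ (ht _)]
  refine ⟨fun k i => mul_le_mul_of_nonneg_right (h.1 k i) (ht i).le, ?_, fun k l hkl => ?_⟩
  · ext x
    rw [hIcc, ← h.2.1]
    simp only [mem_iUnion, hIcc]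
  · refine Set.disjoint_left.2 fun x hx hx' => Set.disjoint_left.1 (h.2.2 hkl) ((hIoo _ _ x).1 hx) ((hIoo _ _ x).1 hx')

theorem IsBoxPartition.le_left {N m : ℕ} {a b : Fin N → ℝ} {c d : Fin m → Fin N → ℝ}
    (h : IsBoxPartition a b c d) (k : Fin m) : a ≤ c k := by
  have hmem : c k ∈ Set.pi Set.univ (fun i => Set.Icc (a i) (b i)) := by
    rw [← h.2.1]
    exact mem_iUnion.2 ⟨k, fun i _ => ⟨le_rfl, h.1 k i⟩⟩
  exact fun i => (hmem i (mem_univ i)).1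

theorem sum_lintegral_le_lintegral_sum {α ι : Type*} [MeasurableSpace α] {μ : Measure α}
    (s : Finset ι) (y : ι → α → ℝ≥0∞) :
    ∑ j ∈ s, ∫⁻ t, y j t ∂μ ≤ ∫⁻ t, ∑ j ∈ s, y j t ∂μ := by
  classical
  induction s using Finset.induction_on with
  | empty => simp
  | insert j s hj ih =>
    simp only [Finset.sum_insert hj]
    exact (add_le_add_right ih _).trans (le_lintegral_add _ _)

theorem IsBoxPartition.sum_boxPhi_le_totalVar {N m : ℕ} {a b : Fin N → ℝ}
    {c d : Fin m → Fin N → ℝ} (h : IsBoxPartition a b c d) (φ : ℝ → ℝ) (f : (Fin N → ℝ) → ℝ)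
    (ha : ∀ i, 0 < a i) (hab : ∀ i, a i ≤ b i) :
    ∑ k, boxPhi φ f (c k) (d k) ≤ totalVar φ f :=
  le_iSup_of_le a <| le_iSup_of_le b <| le_iSup_of_le ha <| le_iSup_of_le hab <|
    le_iSup_of_le m <| le_iSup_of_le c <| le_iSup_of_le d <| le_iSup_of_le h le_rfl

/-- Minkowski's integral inequality for the Euclidean norm. -/
theorem rpow_sum_sq_le_lintegral {α ι : Type*} [Fintype ι] [MeasurableSpace α] {μ : Measure α}
    {x : ι → ℝ≥0∞} {y : ι → α → ℝ≥0∞} (h : ∀ j, x j ≤ ∫⁻ t, y j t ∂μ) :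
    (∑ j, x j ^ 2) ^ ((1 : ℝ) / 2) ≤ ∫⁻ t, (∑ j, y j t ^ 2) ^ ((1 : ℝ) / 2) ∂μ := by
  have hle : ∀ (z : ι → ℝ≥0∞) (j : ι), z j ≤ (∑ i, z i ^ 2) ^ ((1 : ℝ) / 2) := fun z j => by
    calc z j = (z j ^ 2) ^ ((1 : ℝ) / 2) := by
          rw [← ENNReal.rpow_natCast, ← ENNReal.rpow_mul]; norm_num
      _ ≤ _ := ENNReal.rpow_le_rpow
          (Finset.single_le_sum (f := fun i => z i ^ 2) (fun _ _ => zero_le) (Finset.mem_univ j))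
          (by norm_num)
  set A := (∑ j, x j ^ 2) ^ ((1 : ℝ) / 2) with hA
  set B := ∫⁻ t, (∑ j, y j t ^ 2) ^ ((1 : ℝ) / 2) ∂μ with hB
  by_cases hx : ∃ j, x j = ∞
  · obtain ⟨j, hj⟩ := hx
    refine le_top.trans ?_
    rw [← hj]
    exact (h j).trans (lintegral_mono fun t => hle (fun i => y i t) j)
  push Not at hx
  have hAtop : A ≠ ∞ := ENNReal.rpow_ne_top_of_nonneg (by norm_num)
    (ENNReal.sum_ne_top.2 fun j _ => ENNReal.pow_ne_top (hx j))
  rcases eq_or_ne A 0 with h0 | h0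
  · rw [h0]; exact zero_le
  have hAA : A * A = ∑ j, x j ^ 2 := by
    rw [← sq, hA, ← ENNReal.rpow_natCast, ← ENNReal.rpow_mul]; norm_num
  refine (ENNReal.mul_le_mul_iff_right h0 hAtop).1 ?_
  calc A * A = ∑ j, x j * x j := by rw [hAA]; simp only [sq]
    _ ≤ ∑ j, x j * ∫⁻ t, y j t ∂μ := by gcongr with j; exact h j
    _ = ∑ j, ∫⁻ t, x j * y j t ∂μ := by simp only [lintegral_const_mul' _ _ (hx _)]
    _ ≤ ∫⁻ t, ∑ j, x j * y j t ∂μ := sum_lintegral_le_lintegral_sum _ _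
    _ ≤ ∫⁻ t, A * (∑ j, y j t ^ 2) ^ ((1 : ℝ) / 2) ∂μ := by
      refine lintegral_mono fun t => ?_
      have := ENNReal.inner_le_Lp_mul_Lq Finset.univ x (fun j => y j t)
        (p := 2) (q := 2) (by constructor <;> norm_num)
      simpa [hA] using this
    _ = A * B := lintegral_const_mul' _ _ hAtop

theorem phiVar1_integral_le {α : Type*} [MeasurableSpace α] {μ : Measure α} {a b : ℝ}
    {g : ℝ → α → ℝ} (hg : ∀ s ∈ Icc a b, Integrable (g s) μ) :
    phiVar1 (fun u => u) a b (fun s => ∫ t, g s t ∂μ) ≤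
      ∫⁻ t, phiVar1 (fun u => u) a b (fun s => g s t) ∂μ := by
  refine iSup_le fun n => iSup_le fun u => iSup_le fun hu => iSup_le fun h0 => iSup_le fun h1 => ?_
  have hmem : ∀ i, u i ∈ Icc a b := fun i =>
    ⟨h0 ▸ hu (Fin.zero_le i), h1 ▸ hu (Fin.le_last i)⟩
  calc ∑ i : Fin n, ENNReal.ofReal |(∫ t, g (u i.succ) t ∂μ) - ∫ t, g (u i.castSucc) t ∂μ|
      ≤ ∑ i : Fin n, ∫⁻ t, ENNReal.ofReal |g (u i.succ) t - g (u i.castSucc) t| ∂μ := by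
        refine Finset.sum_le_sum fun i _ => ?_
        rw [← integral_sub (hg _ (hmem _)) (hg _ (hmem _))]
        simp only [← Real.enorm_eq_ofReal_abs]
        exact enorm_integral_le_lintegral_enorm _
    _ ≤ ∫⁻ t, ∑ i : Fin n, ENNReal.ofReal |g (u i.succ) t - g (u i.castSucc) t| ∂μ :=
        sum_lintegral_le_lintegral_sum _ _
    _ ≤ _ := lintegral_mono fun t => le_phiVar1 (fun u => u) (fun s => g s t) hu h0 h1

theorem secVar_integral_le {N : ℕ} {μ : Measure (Fin N → ℝ)} [IsFiniteMeasure μ]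
    {f : (Fin N → ℝ) → ℝ} (hf : Measurable f)
    (hint : ∀ s ∈ RPos N, Integrable (fun t => f (s * t)) μ) {a : Fin N → ℝ}
    (ha : ∀ i, 0 < a i) (b : Fin N → ℝ) (j : Fin N) :
    secVar (fun u => u) (fun s => ∫ t, f (s * t) ∂μ) a b j ≤
      ∫⁻ t, secVar (fun u => u) (fun s => f (s * t)) a b j ∂μ := by
  set B := Set.pi Set.univ (fun i : {i : Fin N // i ≠ j} => Set.Icc (a i.1) (b i.1)) with hB
  have hBm : MeasurableSet B := .univ_pi fun i => measurableSet_Icc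
  have : IsFiniteMeasure (volume.restrict B) :=
    ⟨by
      rw [Measure.restrict_apply_univ]
      exact (isCompact_univ_pi fun i => isCompact_Icc).measure_lt_top⟩
  have hw : Measurable fun x' : {i : Fin N // i ≠ j} → ℝ =>
      ENNReal.ofReal ((∏ i : {i : Fin N // i ≠ j}, x' i)⁻¹) :=
    ENNReal.measurable_ofReal.comp
      (Finset.measurable_prod _ fun i _ => measurable_pi_apply i).inv
  have hg : Measurable (Function.uncurry
      fun (q : ({i : Fin N // i ≠ j} → ℝ) × (Fin N → ℝ)) (s : ℝ) =>
        f (insertCoord j q.1 s * q.2)) :=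
    hf.comp (((measurable_insertCoord j).comp
      ((measurable_fst.comp measurable_fst).prodMk measurable_snd)).mul
        (measurable_snd.comp measurable_fst))
  calc secVar (fun u => u) (fun s => ∫ t, f (s * t) ∂μ) a b j
      ≤ ∫⁻ x' in B, ∫⁻ t, phiVar1 (fun u => u) (a j) (b j)
          (fun s => f (insertCoord j x' s * t)) *
            ENNReal.ofReal ((∏ i : {i : Fin N // i ≠ j}, x' i)⁻¹) ∂μ := by
        refine setLIntegral_mono' hBm fun x' hx' => ?_
        rw [lintegral_mul_const' _ _ ENNReal.ofReal_ne_top]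
        gcongr
        exact phiVar1_integral_le fun s hs => hint _ <| insertCoord_mem_RPos
          (fun i => (ha i.1).trans_le (hx' i (mem_univ i)).1) ((ha j).trans_le hs.1)
    _ = _ := lintegral_lintegral_swap <|
        (aemeasurable_phiVar1 _ measurable_id (a j) (b j) hg).mul
          (hw.comp measurable_fst).aemeasurable

/-- Averaging the dilations of `f` against a probability measure on the positive orthant does not
increase the Tonelli variation. -/
theorem totalVar_integral_le {N : ℕ} {μ : Measure (Fin N → ℝ)} [IsProbabilityMeasure μ]
    (hμ : ∀ᵐ t ∂μ, t ∈ RPos N) {f : (Fin N → ℝ) → ℝ} (hf : Measurable f)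
    (hint : ∀ s ∈ RPos N, Integrable (fun t => f (s * t)) μ) :
    totalVar (fun u => u) (fun s => ∫ t, f (s * t) ∂μ) ≤ totalVar (fun u => u) f := by
  refine iSup_le fun a => iSup_le fun b => iSup_le fun ha => iSup_le fun hab =>
    iSup_le fun m => iSup_le fun c => iSup_le fun d => iSup_le fun hcd => ?_
  calc ∑ k, boxPhi (fun u => u) (fun s => ∫ t, f (s * t) ∂μ) (c k) (d k)
      ≤ ∑ k, ∫⁻ t, boxPhi (fun u => u) (fun s => f (s * t)) (c k) (d k) ∂μ :=
        Finset.sum_le_sum fun k _ => rpow_sum_sq_le_lintegral fun j =>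
          secVar_integral_le hf hint (fun i => (ha i).trans_le (hcd.le_left k i)) (d k) j
    _ ≤ ∫⁻ t, ∑ k, boxPhi (fun u => u) (fun s => f (s * t)) (c k) (d k) ∂μ :=
        sum_lintegral_le_lintegral_sum _ _
    _ ≤ ∫⁻ _, totalVar (fun u => u) f ∂μ := by
        refine lintegral_mono_ae ?_
        filter_upwards [hμ] with t ht
        calc ∑ k, boxPhi (fun u => u) (fun s => f (s * t)) (c k) (d k)
            ≤ ∑ k, boxPhi (fun u => u) f (c k * t) (d k * t) :=
              Finset.sum_le_sum fun k _ => boxPhi_comp_mul_le _ f _ _ ht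
          _ ≤ _ := (hcd.mul ht).sum_boxPhi_le_totalVar _ f
              (fun i => mul_pos (ha i) (ht i))
              fun i => mul_le_mul_of_nonneg_right (hab i) (ht i).le
    _ = totalVar (fun u => u) f := by simp

theorem measurableSet_RPos (N : ℕ) : MeasurableSet (RPos N) := by
  rw [RPos, ofPred_forall]
  exact .iInter fun i => measurableSet_lt measurable_const (measurable_pi_apply i)

/-- for `φ = id` (classical Tonelli variation `V = V^{id}`), non-negative
kernels with `∫ K_w dμ = 1`, and `f` measurable of bounded Tonelli variation in the
domain of the operators, one has `V[T_w f] ≤ V[f]` for every `w > 0`. -/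
theorem statement2 {N : ℕ} (hN : 1 ≤ N)
    (K : ℝ → (Fin N → ℝ) → ℝ)
    (hmeas : ∀ w > (0 : ℝ), Measurable (K w))
    (hpos : ∀ w > (0 : ℝ), ∀ t, 0 ≤ K w t)
    (hint : ∀ w > (0 : ℝ), IntegrableOn (fun t => K w t * (prodCoord t)⁻¹) (RPos N))
    (hone : ∀ w > (0 : ℝ), (∫ t in RPos N, K w t * (prodCoord t)⁻¹) = 1)
    (f : (Fin N → ℝ) → ℝ) (hf : Measurable f)
    (hBV : totalVar (fun u => u) f < ⊤) (hdom : InDomain K f) :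
    ∀ w > (0 : ℝ),
      totalVar (fun u => u) (mellinOp (K w) f) ≤ totalVar (fun u => u) f := by
  intro w hw
  set ρ : (Fin N → ℝ) → ℝ := fun t => K w t * (prodCoord t)⁻¹ with hρ
  have hρ0 : ∀ᵐ t ∂volume.restrict (RPos N), 0 ≤ ρ t := by
    filter_upwards [ae_restrict_mem (measurableSet_RPos N)] with t ht
    exact mul_nonneg (hpos w hw t) (inv_nonneg.2 (Finset.prod_nonneg fun i _ => (ht i).le))
  have hρm : Measurable fun t => ENNReal.ofReal (ρ t) :=
    ENNReal.measurable_ofReal.comp ((hmeas w hw).mul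
      (Finset.measurable_prod _ fun i _ => measurable_pi_apply i).inv)
  have hρtop : ∀ᵐ t ∂volume.restrict (RPos N), ENNReal.ofReal (ρ t) < ∞ :=
    .of_forall fun _ => ENNReal.ofReal_lt_top
  set μ := (volume.restrict (RPos N)).withDensity fun t => ENNReal.ofReal (ρ t) with hμ
  have : IsProbabilityMeasure μ := ⟨by
    rw [hμ, withDensity_apply _ .univ, setLIntegral_univ,
      ← ofReal_integral_eq_lintegral_ofReal (hint w hw) hρ0, hone w hw, ENNReal.ofReal_one]⟩
  have hμpos : ∀ᵐ t ∂μ, t ∈ RPos N :=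
    (withDensity_absolutelyContinuous _ _).ae_le (ae_restrict_mem (measurableSet_RPos N))
  have hsmul : ∀ s : Fin N → ℝ, (fun t => (ENNReal.ofReal (ρ t)).toReal • f (s * t))
      =ᵐ[volume.restrict (RPos N)] fun t => K w t * f (s * t) * (prodCoord t)⁻¹ := fun s => by
    filter_upwards [hρ0] with t ht
    rw [ENNReal.toReal_ofReal ht, smul_eq_mul, hρ]
    ring
  have hT : mellinOp (K w) f = fun s => ∫ t, f (s * t) ∂μ := by
    ext s
    rw [hμ, integral_withDensity_eq_integral_toReal_smul hρm hρtop, integral_congr_ae (hsmul s),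
      mellinOp]
  rw [hT]
  refine totalVar_integral_le hμpos hf fun s hs => ?_
  rw [hμ, integrable_withDensity_iff_integrable_smul' hρm hρtop, integrable_congr (hsmul s)]
  exact hdom w hw s hs

end
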